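/- arXiv:2509.22620 — 2 statements merged into one kernel-verified Lean document; each statement's English description precedes it below -/
import Mathlib

section
/- Quadratic voting amplifies minimal holders: Suppose the token balances are not all equal, i.e., there exist players p, q ∈ P with tokens(p) ≠ tokens(q). Then every player p₀ whose token balance is minimal (tokens(p₀) ≤ tokens(p) for all p ∈ P) satisfies qv(p₀, tokens) = 1, i.e., tokens(p₀)/T < √(tokens(p₀))/S. -/
open Finset

/-- **Quadratic voting amplifies minimal holders.** If token balances are not all equal,
then every player with a minimal token balance benefits from quadratic voting:
`tokens(p₀)/T < √(tokens(p₀))/S`. -/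
theorem qv_amplifies_minimal_holders
    {α : Type*} (P : Finset α) (hP : P.Nonempty)
    (tokens : α → ℝ) (htok : ∀ p ∈ P, 0 < tokens p)
    (hne : ∃ p ∈ P, ∃ q ∈ P, tokens p ≠ tokens q)
    (p₀ : α) (hp₀ : p₀ ∈ P) (hmin : ∀ p ∈ P, tokens p₀ ≤ tokens p) :
    tokens p₀ / (∑ q ∈ P, tokens q) <
      Real.sqrt (tokens p₀) / (∑ q ∈ P, Real.sqrt (tokens q)) := by
  have hT : 0 < ∑ q ∈ P, tokens q := Finset.sum_pos htok hP
  have hS : 0 < ∑ q ∈ P, Real.sqrt (tokens q) :=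
    Finset.sum_pos (fun q hq => Real.sqrt_pos.mpr (htok q hq)) hP
  have h0 : 0 < Real.sqrt (tokens p₀) := Real.sqrt_pos.mpr (htok p₀ hp₀)
  have key : ∀ q ∈ P, Real.sqrt (tokens p₀) * tokens q - tokens p₀ * Real.sqrt (tokens q) =
      Real.sqrt (tokens p₀) * Real.sqrt (tokens q) *
        (Real.sqrt (tokens q) - Real.sqrt (tokens p₀)) := by
    intro q hq
    have h1 := Real.mul_self_sqrt (htok p₀ hp₀).le
    have h2 := Real.mul_self_sqrt (htok q hq).le
    linear_combination (-Real.sqrt (tokens p₀)) * h2 + Real.sqrt (tokens q) * h1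
  have hr : ∃ r ∈ P, tokens p₀ < tokens r := by
    obtain ⟨p, hp, q, hq, hpq⟩ := hne
    by_contra! hcon
    exact hpq ((le_antisymm (hcon p hp) (hmin p hp)).trans
      (le_antisymm (hmin q hq) (hcon q hq)))
  rw [div_lt_div_iff₀ hT hS, Finset.mul_sum, Finset.mul_sum]
  apply Finset.sum_lt_sum
  · intro q hq
    have h3 : 0 ≤ Real.sqrt (tokens q) - Real.sqrt (tokens p₀) :=
      sub_nonneg.mpr (Real.sqrt_le_sqrt (hmin q hq))
    rw [← sub_nonneg, key q hq]
    positivity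
  · obtain ⟨r, hrP, hlt⟩ := hr
    refine ⟨r, hrP, ?_⟩
    have h3 : 0 < Real.sqrt (tokens r) - Real.sqrt (tokens p₀) :=
      sub_pos.mpr (Real.sqrt_lt_sqrt (htok p₀ hp₀).le hlt)
    have h4 : 0 < Real.sqrt (tokens r) := Real.sqrt_pos.mpr (htok r hrP)
    rw [← sub_pos, key r hrP]
    positivity
end

section
/- Quadratic voting dilutes whales: Suppose the token balances are not all equal, i.e., there exist players p, q ∈ P with tokens(p) ≠ tokens(q). Then every player p₁ whose token balance is maximal (tokens(p₁) ≥ tokens(p) for all p ∈ P) satisfies tokens(p₁)/T > √(tokens(p₁))/S, i.e., the largest token holder's fraction of total voting weight strictly decreases under quadratic voting. -/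
open Finset

/-- **Quadratic voting dilutes whales.** If token balances are not all equal, then every
player with a maximal token balance has its fraction of total voting weight strictly
decreased under quadratic voting: `tokens(p₁)/T > √(tokens(p₁))/S`. -/
theorem qv_dilutes_whales
    {α : Type*} (P : Finset α) (hP : P.Nonempty)
    (tokens : α → ℝ) (htok : ∀ p ∈ P, 0 < tokens p)
    (hne : ∃ p ∈ P, ∃ q ∈ P, tokens p ≠ tokens q)
    (p₁ : α) (hp₁ : p₁ ∈ P) (hmax : ∀ p ∈ P, tokens p ≤ tokens p₁) :
    tokens p₁ / (∑ q ∈ P, tokens q) >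
      Real.sqrt (tokens p₁) / (∑ q ∈ P, Real.sqrt (tokens q)) := by
  have hT : 0 < ∑ q ∈ P, tokens q := Finset.sum_pos htok hP
  have hS : 0 < ∑ q ∈ P, Real.sqrt (tokens q) :=
    Finset.sum_pos (fun q hq => Real.sqrt_pos.mpr (htok q hq)) hP
  have ha : 0 < Real.sqrt (tokens p₁) := Real.sqrt_pos.mpr (htok p₁ hp₁)
  have key : ∀ q ∈ P, tokens p₁ * Real.sqrt (tokens q) - Real.sqrt (tokens p₁) * tokens q
      = Real.sqrt (tokens p₁) * Real.sqrt (tokens q)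
        * (Real.sqrt (tokens p₁) - Real.sqrt (tokens q)) := by
    intro q hq
    have h1 := Real.mul_self_sqrt (htok p₁ hp₁).le
    have h2 := Real.mul_self_sqrt (htok q hq).le
    linear_combination (-Real.sqrt (tokens q)) * h1 + Real.sqrt (tokens p₁) * h2
  obtain ⟨r, hr, hlt⟩ : ∃ r ∈ P, tokens r < tokens p₁ := by
    by_contra! h
    obtain ⟨p, hp, q, hq, hpq⟩ := hne
    exact hpq ((le_antisymm (hmax p hp) (h p hp)).trans
      (le_antisymm (hmax q hq) (h q hq)).symm)
  rw [gt_iff_lt, div_lt_div_iff₀ hS hT, Finset.mul_sum, Finset.mul_sum]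
  refine Finset.sum_lt_sum (fun q hq => ?_) ⟨r, hr, ?_⟩
  · rw [← sub_nonneg, key q hq]
    exact mul_nonneg (mul_nonneg ha.le (Real.sqrt_nonneg _))
      (sub_nonneg.mpr (Real.sqrt_le_sqrt (hmax q hq)))
  · rw [← sub_pos, key r hr]
    exact mul_pos (mul_pos ha (Real.sqrt_pos.mpr (htok r hr)))
      (sub_pos.mpr (Real.sqrt_lt_sqrt (htok r hr).le hlt))
end
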